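/- Let M be exponentially distributed with parameter λ > 0 and b ∈ ℝ. There exists an equilibrium with at least three bins (edges 0 < m_1 < m_2 < ∞ satisfying the centroid and nearest-neighbor conditions) if and only if b > −(1/(2λ))·(e − 2)/(e − 1). -/

import Mathlib

open MeasureTheory Set Filter

/-- Conditional mean `E[M | M ∈ s]` of a random variable with density `f`. -/
noncomputable def condMean (f : ℝ → ℝ) (s : Set ℝ) : ℝ :=
  (∫ x in s, x * f x) / (∫ x in s, f x)

/-- The bin (interval) of real numbers between two extended-real edges `lo` and `hi`. -/
def ebin (lo hi : EReal) : Set ℝ := {x : ℝ | lo ≤ (x : EReal) ∧ (x : EReal) < hi}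

/-- Edges `m_0 = m_L < m_1 < ⋯ < m_{N−1} < m_N = +∞` of an `N`-bin quantizer with interior
edges `m : Fin (N−1) → ℝ`, for a source supported on `[m_L, ∞)`. -/
noncomputable def edgesL (mL : ℝ) (N : ℕ) (m : Fin (N - 1) → ℝ) (k : ℕ) : EReal :=
  if hk : k = 0 then (mL : EReal)
  else if h : k ≤ N - 1 then ((m ⟨k - 1, by omega⟩ : ℝ) : EReal)
  else ⊤

/-- `m : Fin (N−1) → ℝ` is the vector of interior edges of an `N`-bin cheap-talk equilibrium
for a source with density `f` supported on `[m_L, ∞)` and bias `b`: the interior edges are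
strictly increasing, lie above `m_L`, and every interior edge `m_k` satisfies the
centroid/nearest-neighbor condition
`m_k = (E[M | m_{k−1} ≤ M < m_k] + E[M | m_k ≤ M < m_{k+1}])/2 + b`. -/
def IsEqL (f : ℝ → ℝ) (mL b : ℝ) (N : ℕ) (m : Fin (N - 1) → ℝ) : Prop :=
  StrictMono m ∧ (∀ k, mL < m k) ∧ ∀ k : Fin (N - 1),
    m k = (condMean f (ebin (edgesL mL N m k.val) (edgesL mL N m (k.val + 1)))
         + condMean f (ebin (edgesL mL N m (k.val + 1)) (edgesL mL N m (k.val + 2)))) / 2 + b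

/-- The exponential density with rate `lam`: `f(x) = λ e^{−λx}` for `x ≥ 0`, `0` otherwise. -/
noncomputable def expPDF (lam : ℝ) (x : ℝ) : ℝ :=
  if 0 ≤ x then lam * Real.exp (-lam * x) else 0

/-- Distance from the centroid of a bin of length `l` of the exponential source with rate `lam`
to the right edge of that bin. -/
noncomputable def expRightGap (lam l : ℝ) : ℝ := l - 1 / lam + l / (Real.exp (lam * l) - 1)

theorem ebin_coe_coe (a c : ℝ) : ebin (a : EReal) (c : EReal) = Ico a c := by
  ext x; simp [ebin]

theorem ebin_coe_top (a : ℝ) : ebin (a : EReal) ⊤ = Ici a := by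
  ext x; simp [ebin]

theorem hasDerivAt_neg_exp_neg_mul (lam x : ℝ) :
    HasDerivAt (fun x => -Real.exp (-lam * x)) (lam * Real.exp (-lam * x)) x := by
  have h := (((hasDerivAt_id x).const_mul (-lam)).exp).neg
  refine h.congr_deriv ?_
  simp only [id, mul_one]
  ring

theorem hasDerivAt_neg_add_inv_mul_exp {lam : ℝ} (hlam : 0 < lam) (x : ℝ) :
    HasDerivAt (fun x => -((x + 1 / lam) * Real.exp (-lam * x)))
      (x * (lam * Real.exp (-lam * x))) x := by
  have h := (((hasDerivAt_id x).add_const (1 / lam)).mul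
    (((hasDerivAt_id x).const_mul (-lam)).exp)).neg
  refine h.congr_deriv ?_
  simp only [id, mul_one]
  field_simp
  ring

theorem condMean_expPDF_of_nonneg {lam : ℝ} {s : Set ℝ} (hs : MeasurableSet s)
    (h : ∀ x ∈ s, 0 ≤ x) :
    condMean (expPDF lam) s =
      (∫ x in s, x * (lam * Real.exp (-lam * x))) / ∫ x in s, lam * Real.exp (-lam * x) := by
  have hf : ∀ x ∈ s, expPDF lam x = lam * Real.exp (-lam * x) := fun x hx => if_pos (h x hx)
  rw [condMean, setIntegral_congr_fun hs hf,
    setIntegral_congr_fun hs fun x hx => congrArg (x * ·) (hf x hx)]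

theorem condMean_expPDF_Ico {lam a c : ℝ} (hlam : 0 < lam) (ha : 0 ≤ a) (hac : a < c) :
    condMean (expPDF lam) (Ico a c) =
      1 / lam + a - (c - a) / (Real.exp (lam * (c - a)) - 1) := by
  rw [condMean_expPDF_of_nonneg measurableSet_Ico fun x hx => ha.trans hx.1,
    integral_Ico_eq_integral_Ioc, integral_Ico_eq_integral_Ioc,
    ← intervalIntegral.integral_of_le hac.le, ← intervalIntegral.integral_of_le hac.le,
    intervalIntegral.integral_eq_sub_of_hasDerivAt
      (fun x _ => hasDerivAt_neg_add_inv_mul_exp hlam x)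
      (Continuous.intervalIntegrable (by fun_prop) _ _),
    intervalIntegral.integral_eq_sub_of_hasDerivAt
      (fun x _ => hasDerivAt_neg_exp_neg_mul lam x)
      (Continuous.intervalIntegrable (by fun_prop) _ _)]
  have hE : 1 < Real.exp (lam * (c - a)) := Real.one_lt_exp_iff.2 (mul_pos hlam (sub_pos.2 hac))
  have hsplit : Real.exp (-lam * a) = Real.exp (lam * (c - a)) * Real.exp (-lam * c) := by
    rw [← Real.exp_add]; ring_nf
  have hpos := Real.exp_pos (-lam * c)
  rw [hsplit]
  generalize Real.exp (lam * (c - a)) = E at *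
  generalize Real.exp (-lam * c) = y at *
  have h1 : E - 1 ≠ 0 := by linarith
  have h2 : -y - -(E * y) = y * (E - 1) := by ring
  rw [h2]
  field_simp
  ring

theorem tendsto_exp_neg_mul_atTop {lam : ℝ} (hlam : 0 < lam) :
    Tendsto (fun x : ℝ => Real.exp (-lam * x)) atTop (nhds 0) :=
  Real.tendsto_exp_atBot.comp (tendsto_id.const_mul_atTop_of_neg (neg_lt_zero.2 hlam))

theorem tendsto_mul_exp_neg_mul_atTop {lam : ℝ} (hlam : 0 < lam) :
    Tendsto (fun x : ℝ => x * Real.exp (-lam * x)) atTop (nhds 0) := by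
  have h := ((Real.tendsto_pow_mul_exp_neg_atTop_nhds_zero 1).comp
    (tendsto_id.const_mul_atTop hlam)).const_mul (1 / lam)
  rw [mul_zero] at h
  refine h.congr fun x => ?_
  simp only [Function.comp, id, pow_one, neg_mul]
  field_simp

theorem condMean_expPDF_Ici {lam a : ℝ} (hlam : 0 < lam) (ha : 0 ≤ a) :
    condMean (expPDF lam) (Ici a) = a + 1 / lam := by
  have h0 := tendsto_exp_neg_mul_atTop hlam
  have hnum : Tendsto (fun x => -((x + 1 / lam) * Real.exp (-lam * x))) atTop (nhds 0) := by
    have h := ((tendsto_mul_exp_neg_mul_atTop hlam).add (h0.const_mul (1 / lam))).neg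
    simp only [mul_zero, add_zero, neg_zero] at h
    exact h.congr fun x => by ring
  have hden : Tendsto (fun x => -Real.exp (-lam * x)) atTop (nhds 0) := by simpa using h0.neg
  rw [condMean_expPDF_of_nonneg measurableSet_Ici fun x hx => ha.trans hx,
    integral_Ici_eq_integral_Ioi, integral_Ici_eq_integral_Ioi,
    integral_Ioi_of_hasDerivAt_of_nonneg' (fun x _ => hasDerivAt_neg_add_inv_mul_exp hlam x)
      (fun x hx => mul_nonneg (ha.trans (le_of_lt hx)) (by positivity)) hnum,
    integral_Ioi_of_hasDerivAt_of_nonneg' (fun x _ => hasDerivAt_neg_exp_neg_mul lam x)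
      (fun x _ => by positivity) hden]
  have := (Real.exp_pos (-lam * a)).ne'
  field_simp
  ring

theorem exp_mul_sub_one_pos {lam l : ℝ} (hlam : 0 < lam) (hl : 0 < l) :
    0 < Real.exp (lam * l) - 1 :=
  sub_pos.2 (Real.one_lt_exp_iff.2 (mul_pos hlam hl))

theorem expRightGap_pos {lam l : ℝ} (hlam : 0 < lam) (hl : 0 < l) : 0 < expRightGap lam l := by
  have hE := exp_mul_sub_one_pos hlam hl
  have hneg := Real.add_one_lt_exp (neg_ne_zero.2 (mul_pos hlam hl).ne')
  have hinv : Real.exp (-(lam * l)) * Real.exp (lam * l) = 1 := by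
    rw [← Real.exp_add]; simp
  have hpos := Real.exp_pos (lam * l)
  have key : expRightGap lam l = (Real.exp (lam * l) * (lam * l) - (Real.exp (lam * l) - 1)) /
      (lam * (Real.exp (lam * l) - 1)) := by
    have hE' := hE.ne'
    rw [expRightGap]
    generalize Real.exp (lam * l) = E at *
    field_simp
    ring
  rw [key]
  apply div_pos _ (mul_pos hlam hE)
  nlinarith

theorem expRightGap_le_self {lam l : ℝ} (hlam : 0 < lam) (hl : 0 < l) :
    expRightGap lam l ≤ l := by
  have hE := exp_mul_sub_one_pos hlam hl
  have h : l / (Real.exp (lam * l) - 1) ≤ 1 / lam := by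
    rw [div_le_div_iff₀ hE hlam]
    linarith [Real.add_one_le_exp (lam * l)]
  rw [expRightGap]
  linarith

theorem expRightGap_strictMonoOn {lam : ℝ} (hlam : 0 < lam) :
    StrictMonoOn (expRightGap lam) (Ioi 0) := by
  have hrepr : ∀ l : ℝ, 0 < l → expRightGap lam l =
      1 / (lam * ((Real.exp (-(lam * l)) - Real.exp 0) / (-(lam * l) - 0))) - 1 / lam := by
    intro l hl
    have hE := exp_mul_sub_one_pos hlam hl
    have hE' := hE.ne'
    have hpos := Real.exp_pos (lam * l)
    rw [expRightGap, Real.exp_neg, Real.exp_zero]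
    generalize Real.exp (lam * l) = E at *
    have h1 : E⁻¹ - 1 = -((E - 1) / E) := by
      field_simp; ring
    rw [h1, sub_zero, neg_div_neg_eq]
    field_simp
    ring
  intro x hx y hy hxy
  have hx' : 0 < x := hx
  have hy' : 0 < y := hy
  have hmul := mul_lt_mul_of_pos_left hxy hlam
  have hlx := mul_pos hlam hx'
  have hly := mul_pos hlam hy'
  have hsec := strictConvexOn_exp.secant_strict_mono (mem_univ (0 : ℝ)) (mem_univ (-(lam * y)))
    (mem_univ (-(lam * x))) (by linarith) (by linarith) (neg_lt_neg hmul)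
  have hposy : 0 < (Real.exp (-(lam * y)) - Real.exp 0) / (-(lam * y) - 0) :=
    div_pos_of_neg_of_neg (sub_neg.2 (Real.exp_lt_exp.2 (by linarith))) (by linarith)
  rw [hrepr x hx', hrepr y hy']
  have := one_div_lt_one_div_of_lt (mul_pos hlam hposy) (mul_lt_mul_of_pos_left hsec hlam)
  linarith

theorem exists_expRightGap_eq {lam c : ℝ} (hlam : 0 < lam) (hc : 0 < c) :
    ∃ l, 0 < l ∧ expRightGap lam l = c := by
  have hle : c ≤ c + 1 / lam := by linarith [one_div_pos.2 hlam]
  have hcont : ContinuousOn (expRightGap lam) (Icc c (c + 1 / lam)) := by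
    unfold expRightGap
    refine ContinuousOn.add (by fun_prop) (ContinuousOn.div (by fun_prop) (by fun_prop) ?_)
    exact fun x hx => (exp_mul_sub_one_pos hlam (hc.trans_le hx.1)).ne'
  have hupper : c ≤ expRightGap lam (c + 1 / lam) := by
    have hp := hc.trans_le hle
    have := div_pos hp (exp_mul_sub_one_pos hlam hp)
    rw [expRightGap]
    linarith
  obtain ⟨l, hl, h⟩ := intermediate_value_Icc hle hcont ⟨expRightGap_le_self hlam hc, hupper⟩
  exact ⟨l, hc.trans_le hl.1, h⟩

/-- The length of a penultimate bin exceeds `1 / lam` exactly when the bias is above the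
three-bin threshold. -/
theorem one_div_lt_iff_of_expRightGap_eq {lam b l : ℝ} (hlam : 0 < lam) (hl : 0 < l)
    (h : expRightGap lam l = 1 / lam + 2 * b) :
    1 / lam < l ↔ b > -(1 / (2 * lam)) * (Real.exp 1 - 2) / (Real.exp 1 - 1) := by
  have hE : 0 < Real.exp 1 - 1 := sub_pos.2 (Real.one_lt_exp_iff.2 one_pos)
  have hval : expRightGap lam (1 / lam) =
      1 / lam + 2 * (-(1 / (2 * lam)) * (Real.exp 1 - 2) / (Real.exp 1 - 1)) := by
    rw [expRightGap, mul_one_div_cancel hlam.ne']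
    field_simp
    ring
  rw [← (expRightGap_strictMonoOn hlam).lt_iff_lt (mem_Ioi.2 (one_div_pos.2 hlam))
    (mem_Ioi.2 hl), h, hval]
  constructor <;> intro _ <;> linarith

theorem eq_condMean_Ico_Ici_iff {lam a p b : ℝ} (hlam : 0 < lam) (ha : 0 ≤ a) (hap : a < p) :
    p = (condMean (expPDF lam) (Ico a p) + condMean (expPDF lam) (Ici p)) / 2 + b ↔
      expRightGap lam (p - a) = 1 / lam + 2 * b := by
  rw [condMean_expPDF_Ico hlam ha hap, condMean_expPDF_Ici hlam (ha.trans hap.le), expRightGap]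
  constructor <;> intro _ <;> linarith

/-- If the last two bins before the unbounded one satisfy the last nearest-neighbor condition,
then the preceding nearest-neighbor condition fixes the right gap of the earlier bin. -/
theorem eq_condMean_Ico_Ico_iff_of_expRightGap_eq {lam a p q b : ℝ} (hlam : 0 < lam)
    (ha : 0 ≤ a) (hap : a < p) (hpq : p < q)
    (h : expRightGap lam (q - p) = 1 / lam + 2 * b) :
    p = (condMean (expPDF lam) (Ico a p) + condMean (expPDF lam) (Ico p q)) / 2 + b ↔
      expRightGap lam (p - a) = q - p - 1 / lam := by
  rw [condMean_expPDF_Ico hlam ha hap, condMean_expPDF_Ico hlam (ha.trans hap.le) hpq]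
  rw [expRightGap] at h ⊢
  constructor <;> intro _ <;> linarith

theorem edgesL_zero (mL : ℝ) (N : ℕ) (m : Fin (N - 1) → ℝ) : edgesL mL N m 0 = (mL : EReal) := by
  simp [edgesL]

theorem edgesL_succ {mL : ℝ} {N : ℕ} {m : Fin (N - 1) → ℝ} {k : ℕ} (hk : k < N - 1) :
    edgesL mL N m (k + 1) = (m ⟨k, hk⟩ : EReal) := by
  simp [edgesL, Nat.succ_le_of_lt hk]

theorem edgesL_of_le {mL : ℝ} {N : ℕ} {m : Fin (N - 1) → ℝ} {k : ℕ} (hk : N - 1 < k) :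
    edgesL mL N m k = ⊤ := by
  simp [edgesL, Nat.ne_of_gt (Nat.zero_lt_of_lt hk), Nat.not_le.2 hk]

/-- A lower edge is a real number in `[mL, m_k)`. -/
theorem exists_edgesL_eq_coe {mL : ℝ} {N : ℕ} {m : Fin (N - 1) → ℝ} (hmono : StrictMono m)
    (hlow : ∀ k, mL < m k) (k : Fin (N - 1)) :
    ∃ a : ℝ, edgesL mL N m k = (a : EReal) ∧ mL ≤ a ∧ a < m k := by
  obtain ⟨k, hk⟩ := k
  cases k with
  | zero => exact ⟨mL, edgesL_zero mL N m, le_rfl, hlow _⟩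
  | succ j =>
    exact ⟨m ⟨j, by omega⟩, edgesL_succ (by omega), (hlow _).le, hmono (by simp)⟩

/-- For an exponential source with parameter `λ > 0` and bias `b`, there
exists a cheap-talk equilibrium with at least three bins if and only if
`b > −(1/(2λ))·(e − 2)/(e − 1)`. -/
theorem exp_threeBin_iff (lam b : ℝ) (hlam : 0 < lam) :
    (∃ N : ℕ, 3 ≤ N ∧ ∃ m : Fin (N - 1) → ℝ, IsEqL (expPDF lam) 0 b N m) ↔
    b > -(1 / (2 * lam)) * (Real.exp 1 - 2) / (Real.exp 1 - 1) := by
  constructor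
  · rintro ⟨N, hN, m, hmono, hlow, heq⟩
    obtain ⟨n, rfl⟩ : ∃ n, N = n + 3 := ⟨N - 3, by omega⟩
    have hk₁ : n < n + 3 - 1 := by omega
    have hk₂ : n + 1 < n + 3 - 1 := by omega
    obtain ⟨a, hedge, ha, hap⟩ := exists_edgesL_eq_coe hmono hlow ⟨n, hk₁⟩
    have hpq : m ⟨n, hk₁⟩ < m ⟨n + 1, hk₂⟩ := hmono (by simp)
    have heq₁ := heq ⟨n, hk₁⟩
    have heq₂ := heq ⟨n + 1, hk₂⟩
    dsimp only at hedge heq₁ heq₂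
    rw [hedge, edgesL_succ hk₁, edgesL_succ hk₂, ebin_coe_coe, ebin_coe_coe] at heq₁
    rw [edgesL_succ hk₁, edgesL_succ hk₂, edgesL_of_le (by omega), ebin_coe_coe,
      ebin_coe_top] at heq₂
    have hlast := (eq_condMean_Ico_Ici_iff hlam (hlow _).le hpq).1 heq₂
    have hprev := (eq_condMean_Ico_Ico_iff_of_expRightGap_eq hlam ha hap hpq hlast).1 heq₁
    refine (one_div_lt_iff_of_expRightGap_eq hlam (sub_pos.2 hpq) hlast).1 ?_
    linarith [expRightGap_pos hlam (sub_pos.2 hap)]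
  · intro hb
    have hc : 0 < 1 / lam + 2 * b := by
      have hE : 0 < Real.exp 1 - 1 := sub_pos.2 (Real.one_lt_exp_iff.2 one_pos)
      have hval : 1 / lam + 2 * (-(1 / (2 * lam)) * (Real.exp 1 - 2) / (Real.exp 1 - 1)) =
          1 / (lam * (Real.exp 1 - 1)) := by
        field_simp
        ring
      have := one_div_pos.2 (mul_pos hlam hE)
      linarith
    obtain ⟨l₂, hl₂, hlast⟩ := exists_expRightGap_eq hlam hc
    have hlt := (one_div_lt_iff_of_expRightGap_eq hlam hl₂ hlast).2 hb
    obtain ⟨l₁, hl₁, hprev⟩ := exists_expRightGap_eq hlam (sub_pos.2 hlt)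
    have hpq : l₁ < l₁ + l₂ := by linarith
    have hlen : l₁ + l₂ - l₁ = l₂ := by ring
    refine ⟨3, le_rfl, ![l₁, l₁ + l₂], ?_, ?_, ?_⟩
    · rw [Fin.strictMono_iff_lt_succ]
      intro i
      fin_cases i
      simpa using hl₂
    · intro i
      fin_cases i
      · exact hl₁
      · exact hl₁.trans hpq
    · intro i
      fin_cases i
      · dsimp only
        rw [edgesL_zero, edgesL_succ (k := 0) (by norm_num), edgesL_succ (k := 1) (by norm_num),
          ebin_coe_coe, ebin_coe_coe]
        refine (eq_condMean_Ico_Ico_iff_of_expRightGap_eq hlam le_rfl hl₁ hpq ?_).2 ?_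
        · rw [← hlast]; exact congrArg _ hlen
        · rw [hlen, sub_zero]; exact hprev
      · dsimp only
        rw [edgesL_succ (k := 0) (by norm_num), edgesL_succ (k := 1) (by norm_num),
          edgesL_of_le (by norm_num), ebin_coe_coe, ebin_coe_top]
        refine (eq_condMean_Ico_Ici_iff hlam hl₁.le hpq).2 ?_
        rw [hlen]; exact hlast
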